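/- arXiv:2605.20377 — 2 statements merged into one kernel-verified Lean document; each statement's English description precedes it below -/
import Mathlib

section
/- Fix A ∈ (-1, 1) and for B ∈ (A, 1) define F(B) = ∫_{-1}^{-B} √((s+B)/((s+A)(1-s²))) ds. Then F(B) tends to arccos(A) as B tends to A from the right; in particular, the limiting integral satisfies ∫_{-1}^{-A} ds/√(1-s²) = arccos(A). -/
theorem hasDerivAt_arcsin_of_mem_Ioo {s : ℝ} (h₁ : -1 < s) (h₂ : s < 1) :
    HasDerivAt Real.arcsin (1 / Real.sqrt (1 - s ^ 2)) s :=
  Real.hasDerivAt_arcsin h₁.ne' h₂.ne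

theorem intervalIntegrable_one_div_sqrt_one_sub_sq {b : ℝ} (h₁ : -1 ≤ b) (h₂ : b ≤ 1) :
    IntervalIntegrable (fun s : ℝ => 1 / Real.sqrt (1 - s ^ 2)) MeasureTheory.volume (-1) b := by
  rw [intervalIntegrable_iff_integrableOn_Ioc_of_le h₁]
  exact intervalIntegral.integrableOn_deriv_of_nonneg Real.continuous_arcsin.continuousOn
    (fun s hs => hasDerivAt_arcsin_of_mem_Ioo hs.1 (hs.2.trans_le h₂)) (fun s _ => by positivity)

theorem integral_one_div_sqrt_one_sub_sq {b : ℝ} (h₁ : -1 ≤ b) (h₂ : b ≤ 1) :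
    (∫ s in (-1 : ℝ)..b, 1 / Real.sqrt (1 - s ^ 2)) = Real.arccos (-b) := by
  rw [intervalIntegral.integral_eq_sub_of_hasDerivAt_of_le h₁
    Real.continuous_arcsin.continuousOn
    (fun s hs => hasDerivAt_arcsin_of_mem_Ioo hs.1 (hs.2.trans_le h₂))
    (intervalIntegrable_one_div_sqrt_one_sub_sq h₁ h₂),
    Real.arcsin_neg_one, Real.arccos_neg, Real.arccos]
  ring

theorem sqrt_div_eq_zero_of_mem_Ioc {A B s : ℝ} (hA : -1 < A) (hB : B < 1)
    (h₁ : -B < s) (h₂ : s ≤ -A) :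
    Real.sqrt ((s + B) / ((s + A) * (1 - s ^ 2))) = 0 := by
  apply Real.sqrt_eq_zero_of_nonpos
  apply div_nonpos_of_nonneg_of_nonpos (by linarith)
  exact mul_nonpos_of_nonpos_of_nonneg (by linarith) (by nlinarith)

theorem sqrt_div_le_one_div_sqrt {A B s : ℝ} (hA : -1 < A) (hAB : A ≤ B)
    (h₁ : -1 < s) (h₂ : s < -A) :
    Real.sqrt ((s + B) / ((s + A) * (1 - s ^ 2))) ≤ 1 / Real.sqrt (1 - s ^ 2) := by
  have hq : 0 < 1 - s ^ 2 := by nlinarith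
  rw [← div_div, Real.sqrt_div' _ hq.le]
  refine div_le_div_of_nonneg_right (Real.sqrt_le_one.2 ?_) (Real.sqrt_nonneg _)
  rw [div_le_one_of_neg (by linarith)]
  linarith

/-- fix `A ∈ (-1,1)`; the function
`F(B) = ∫_{-1}^{-B} √((s+B)/((s+A)(1-s²))) ds`, defined for `B ∈ (A,1)`, tends to
`arccos A` as `B → A⁺` within `(A,1)`; in particular
`∫_{-1}^{-A} ds/√(1-s²) = arccos A`. -/
theorem slepian_constraint_integral_tendsto_arccos (A : ℝ) (hA : A ∈ Set.Ioo (-1 : ℝ) 1) :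
    Filter.Tendsto
      (fun B : ℝ => ∫ s in (-1 : ℝ)..(-B), Real.sqrt ((s + B) / ((s + A) * (1 - s ^ 2))))
      (nhdsWithin A (Set.Ioo A 1)) (nhds (Real.arccos A)) ∧
    (∫ s in (-1 : ℝ)..(-A), 1 / Real.sqrt (1 - s ^ 2)) = Real.arccos A := by
  obtain ⟨hA₁, hA₂⟩ := hA
  have hle : (-1 : ℝ) ≤ -A := by linarith
  have hlim : (∫ s in (-1 : ℝ)..(-A), 1 / Real.sqrt (1 - s ^ 2)) = Real.arccos A := by
    rw [integral_one_div_sqrt_one_sub_sq hle (by linarith), neg_neg]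
  refine ⟨?_, hlim⟩
  have hext : ∀ B ∈ Set.Ioo A 1,
      (∫ s in (-1 : ℝ)..(-A), Real.sqrt ((s + B) / ((s + A) * (1 - s ^ 2)))) =
        ∫ s in (-1 : ℝ)..(-B), Real.sqrt ((s + B) / ((s + A) * (1 - s ^ 2))) := by
    rintro B ⟨hB₁, hB₂⟩
    rw [intervalIntegral.integral_of_le hle, intervalIntegral.integral_of_le (by linarith)]
    apply MeasureTheory.setIntegral_eq_of_subset_of_forall_sdiff_eq_zero measurableSet_Ioc
      (Set.Ioc_subset_Ioc_right (by linarith))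
    rintro s ⟨⟨hs₁, hs₂⟩, hs⟩
    exact sqrt_div_eq_zero_of_mem_Ioc hA₁ hB₂ (by by_contra! h; exact hs ⟨hs₁, h⟩) hs₂
  have hne : ∀ᵐ s : ℝ, s ≠ -A := by
    simp [MeasureTheory.ae_iff]
  rw [← hlim]
  refine Filter.Tendsto.congr' (Filter.eventuallyEq_of_mem self_mem_nhdsWithin hext) ?_
  refine intervalIntegral.tendsto_integral_filter_of_dominated_convergence
    (fun s => 1 / Real.sqrt (1 - s ^ 2)) ?_ ?_
    (intervalIntegrable_one_div_sqrt_one_sub_sq hle (by linarith)) ?_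
  · exact Filter.Eventually.of_forall fun B =>
      Measurable.aestronglyMeasurable (by fun_prop)
  · filter_upwards [self_mem_nhdsWithin] with B hB
    filter_upwards [hne] with s hs hsI
    rw [Set.uIoc_of_le hle] at hsI
    rw [Real.norm_of_nonneg (Real.sqrt_nonneg _)]
    exact sqrt_div_le_one_div_sqrt hA₁ hB.1.le hsI.1 (lt_of_le_of_ne hsI.2 hs)
  · filter_upwards [hne] with s hs _
    have hsA : s + A ≠ 0 := fun h => hs (by linarith)
    have hval : 1 / Real.sqrt (1 - s ^ 2) =
        Real.sqrt ((s + A) / ((s + A) * (1 - s ^ 2))) := by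
      rw [← div_div, div_self hsA, Real.sqrt_div zero_le_one, Real.sqrt_one]
    rw [hval]
    refine Filter.Tendsto.mono_left (Continuous.tendsto ?_ A) nhdsWithin_le_nhds
    fun_prop
end

section
/- Fix A ∈ (-1, 1) and for B ∈ (A, 1) define F(B) = ∫_{-1}^{-B} √((s+B)/((s+A)(1-s²))) ds. Then F is strictly antitone (strictly decreasing) on the interval (A, 1): if A < B₁ < B₂ < 1 then F(B₂) < F(B₁). -/
theorem slepian_integrand_intervalIntegrable {A B : ℝ} (hA : -1 < A) (hAB : A < B) (hB : B < 1) :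
    IntervalIntegrable (fun s : ℝ => Real.sqrt ((s + B) / ((s + A) * (1 - s ^ 2))))
      MeasureTheory.volume (-1) (-B) := by
  have hbound : IntervalIntegrable (fun s : ℝ => (s + 1) ^ (-(1 / 2) : ℝ) * (1 / Real.sqrt (1 + A)))
      MeasureTheory.volume (-1) (-B) := by
    have h := (intervalIntegral.intervalIntegrable_rpow' (a := 0) (b := -B + 1)
      (r := -(1 / 2)) (by norm_num)).comp_add_right 1
    simpa using h.mul_const (1 / Real.sqrt (1 + A))
  refine hbound.mono_fun (Measurable.aestronglyMeasurable (by fun_prop)) ?_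
  rw [Set.uIoc_of_le (by linarith)]
  refine (MeasureTheory.ae_restrict_iff' measurableSet_Ioc).2 (.of_forall fun s hs => ?_)
  obtain ⟨h1, h2⟩ := hs
  have hs1 : 0 < s + 1 := by linarith
  have hA1 : 0 < 1 + A := by linarith
  beta_reduce
  rw [Real.norm_of_nonneg (Real.sqrt_nonneg _), Real.norm_of_nonneg (by positivity),
    Real.rpow_neg hs1.le, ← Real.sqrt_eq_rpow, ← Real.sqrt_inv, one_div, ← Real.sqrt_inv,
    ← Real.sqrt_mul (by positivity)]
  apply Real.sqrt_le_sqrt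
  rw [← mul_inv, ← div_div]
  have hratio : (s + B) / (s + A) ≤ 1 := (div_le_one_of_neg (by linarith)).2 (by linarith)
  have hs2 : (s + 1) * (1 + A) ≤ 1 - s ^ 2 := by nlinarith
  calc (s + B) / (s + A) / (1 - s ^ 2) ≤ 1 / (1 - s ^ 2) := by
        gcongr
        exact (by positivity : (0 : ℝ) ≤ (s + 1) * (1 + A)).trans hs2
    _ ≤ ((s + 1) * (1 + A))⁻¹ := by
        rw [← one_div]
        gcongr

/-- fix `A ∈ (-1,1)`; the function
`F(B) = ∫_{-1}^{-B} √((s+B)/((s+A)(1-s²))) ds` is strictly decreasing on `(A,1)`. -/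
theorem slepian_constraint_integral_strictAnti (A : ℝ) (hA : A ∈ Set.Ioo (-1 : ℝ) 1) :
    StrictAntiOn
      (fun B : ℝ => ∫ s in (-1 : ℝ)..(-B), Real.sqrt ((s + B) / ((s + A) * (1 - s ^ 2))))
      (Set.Ioo A 1) := by
  intro B hB C hC hBC
  have hA1 := hA.1
  obtain ⟨hB1, hB2⟩ := hB
  obtain ⟨hC1, hC2⟩ := hC
  have hIB := slepian_integrand_intervalIntegrable hA1 hB1 hB2
  have hIC := slepian_integrand_intervalIntegrable hA1 hC1 hC2
  have hleft := hIB.mono_set (c := -1) (d := -C) (by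
    rw [Set.uIcc_of_le (by linarith), Set.uIcc_of_le (by linarith)]
    exact Set.Icc_subset_Icc le_rfl (by linarith))
  have hright := hIB.mono_set (c := -C) (d := -B) (by
    rw [Set.uIcc_of_le (by linarith), Set.uIcc_of_le (by linarith)]
    exact Set.Icc_subset_Icc (by linarith) le_rfl)
  have hmono := intervalIntegral.integral_mono_on_of_le_Ioo (by linarith) hIC hleft
    fun s hs => by
      obtain ⟨h1, h2⟩ := hs
      apply Real.sqrt_le_sqrt
      have hs2 : 0 < 1 - s ^ 2 := by nlinarith
      exact div_le_div_of_nonpos_of_le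
        (mul_nonpos_of_nonpos_of_nonneg (by linarith) hs2.le) (by linarith)
  have hpos := intervalIntegral.intervalIntegral_pos_of_pos_on hright (fun s hs => by
      obtain ⟨h1, h2⟩ := hs
      have hs2 : 0 < 1 - s ^ 2 := by nlinarith
      exact Real.sqrt_pos.2 (div_pos_of_neg_of_neg (by linarith)
        (mul_neg_of_neg_of_pos (by linarith) hs2))) (by linarith)
  have hsplit := intervalIntegral.integral_add_adjacent_intervals hleft hright
  dsimp only
  linarith
end
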